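/- Suppose F ∈ 𝓕₁(I) satisfies hypothesis (H), has exactly m jumps c₁ < ⋯ < c_m, and for some c_i ∈ J(F) the set J(F) ∩ F(c_i) consists of exactly ℓ jumps c_{k₁}, …, c_{k_ℓ}, none of which equals c_i (case J3), where 1 ≤ ℓ < m−1. Then F has no strictly increasing upper semi-continuous iterative root f ∈ 𝓕(I) of order n on I for any n > m − ℓ + 1. -/

import Mathlib

open Set Filter Topology

/-- Iterates of a multifunction: `Iter F 0 x = {x}`, `Iter F (n+1) x = F (Iter F n x)`. -/
def Iter (F : ℝ → Set ℝ) : ℕ → ℝ → Set ℝ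
  | 0 => fun x => {x}
  | n + 1 => fun x => ⋃ y ∈ Iter F n x, F y

/-- Composition of multifunctions: `(G ∘ F)(x) = ⋃ y ∈ F x, G y`. -/
def Comp (G F : ℝ → Set ℝ) : ℝ → Set ℝ := fun x => ⋃ y ∈ F x, G y

/-- Image of a set under a multifunction: `F(A) = ⋃ x ∈ A, F x`. -/
def ImageOf (F : ℝ → Set ℝ) (A : Set ℝ) : Set ℝ := ⋃ x ∈ A, F x

/-- `F` is a multifunction on `[a,b]`: nonempty compact values contained in `[a,b]`. -/
def MFOn (a b : ℝ) (F : ℝ → Set ℝ) : Prop :=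
  ∀ x ∈ Icc a b, (F x).Nonempty ∧ IsCompact (F x) ∧ F x ⊆ Icc a b

/-- Upper semicontinuity of a multifunction at a point, relative to a domain `S`. -/
def USCWithin (S : Set ℝ) (F : ℝ → Set ℝ) (x : ℝ) : Prop :=
  ∀ V : Set ℝ, IsOpen V → F x ⊆ V → ∃ U ∈ 𝓝 x, ∀ y ∈ U ∩ S, F y ⊆ V

/-- Upper semicontinuity on `[a,b]`. -/
def USCOn (a b : ℝ) (F : ℝ → Set ℝ) : Prop :=
  ∀ x ∈ Icc a b, USCWithin (Icc a b) F x

/-- Strictly increasing multifunction: `max F(x) < min F(y)` whenever `x < y` in `[a,b]`. -/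
def SIncOn (a b : ℝ) (F : ℝ → Set ℝ) : Prop :=
  ∀ x ∈ Icc a b, ∀ y ∈ Icc a b, x < y → ∀ u ∈ F x, ∀ v ∈ F y, u < v

/-- Strictly decreasing multifunction: `min F(x) > max F(y)` whenever `x < y` in `[a,b]`. -/
def SDecOn (a b : ℝ) (F : ℝ → Set ℝ) : Prop :=
  ∀ x ∈ Icc a b, ∀ y ∈ Icc a b, x < y → ∀ u ∈ F x, ∀ v ∈ F y, v < u

/-- The class 𝓕(I) of strictly monotone usc multifunctions on `I = [a,b]`. -/
def ClassF (a b : ℝ) (F : ℝ → Set ℝ) : Prop :=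
  MFOn a b F ∧ USCOn a b F ∧ (SIncOn a b F ∨ SDecOn a b F)

/-- The set `J(F)` of jumps (set-valued points) of `F` in `[a,b]`. -/
def Jumps (a b : ℝ) (F : ℝ → Set ℝ) : Set ℝ :=
  {x | x ∈ Icc a b ∧ (F x).Nontrivial}

/-- `k` is the intensity `ζ(F)`: the least `k` with `#J(F^k) = #J(F^{k+1})`. -/
def IsIntensity (a b : ℝ) (F : ℝ → Set ℝ) (k : ℕ) : Prop :=
  IsLeast {j : ℕ | (Jumps a b (Iter F j)).ncard = (Jumps a b (Iter F (j + 1))).ncard} k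

/-- Exclusive multifunctions 𝓕₁(I): members of 𝓕(I) with finitely many jumps and intensity 1. -/
def Exclusive (a b : ℝ) (F : ℝ → Set ℝ) : Prop :=
  ClassF a b F ∧ (Jumps a b F).Finite ∧ IsIntensity a b F 1

/-- Enumeration of the jumps: `c 0 = a`, `c (m+1) = b`, `c` strictly increasing on `{0,…,m+1}`,
and the jumps of `F` are exactly `c 1 < … < c m`.  The subintervals are `I_i = (c i, c (i+1))`. -/
def JumpEnum (a b : ℝ) (F : ℝ → Set ℝ) (m : ℕ) (c : ℕ → ℝ) : Prop :=
  c 0 = a ∧ c (m + 1) = b ∧ (∀ i j : ℕ, i < j → j ≤ m + 1 → c i < c j) ∧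
    Jumps a b F = {x | ∃ i : ℕ, 1 ≤ i ∧ i ≤ m ∧ x = c i}

/-- Hypothesis (H): `F` is strictly increasing, `max F(x) < x` on `(a,b)`, and `max F(b) ≤ b`. -/
def HypH (a b : ℝ) (F : ℝ → Set ℝ) : Prop :=
  SIncOn a b F ∧ (∀ x ∈ Ioo a b, ∀ u ∈ F x, u < x) ∧ (∀ u ∈ F b, u ≤ b)

theorem mem_iter_succ {f : ℝ → Set ℝ} {k : ℕ} {x u : ℝ} :
    u ∈ Iter f (k + 1) x ↔ ∃ y ∈ Iter f k x, u ∈ f y := by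
  simp [Iter]

theorem iter_one (f : ℝ → Set ℝ) (x : ℝ) : Iter f 1 x = f x := by
  simp [Iter]

theorem mem_iter_add {f : ℝ → Set ℝ} {p q : ℕ} {x u : ℝ} :
    u ∈ Iter f (p + q) x ↔ ∃ y ∈ Iter f p x, u ∈ Iter f q y := by
  induction q generalizing u with
  | zero => simp [Iter]
  | succ q ih =>
    rw [← add_assoc, mem_iter_succ]
    simp only [mem_iter_succ, ih]
    constructor
    · rintro ⟨w, ⟨y, hy, hw⟩, hu⟩
      exact ⟨y, hy, w, hw, hu⟩
    · rintro ⟨y, hy, w, hw, hu⟩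
      exact ⟨w, ⟨y, hy, hw⟩, hu⟩

theorem MFOn.iter_subset {a b : ℝ} {f : ℝ → Set ℝ} (hf : MFOn a b f) (k : ℕ) {x : ℝ}
    (hx : x ∈ Icc a b) : Iter f k x ⊆ Icc a b := by
  induction k with
  | zero => simpa [Iter] using hx
  | succ k ih =>
    intro u hu
    obtain ⟨y, hy, hu⟩ := mem_iter_succ.1 hu
    exact (hf y (ih hy)).2.2 hu

theorem MFOn.iter_nonempty {a b : ℝ} {f : ℝ → Set ℝ} (hf : MFOn a b f) (k : ℕ) {x : ℝ}
    (hx : x ∈ Icc a b) : (Iter f k x).Nonempty := by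
  induction k with
  | zero => simp [Iter]
  | succ k ih =>
    obtain ⟨y, hy⟩ := ih
    obtain ⟨u, hu⟩ := (hf y (hf.iter_subset k hx hy)).1
    exact ⟨u, mem_iter_succ.2 ⟨y, hy, hu⟩⟩

theorem SIncOn.iter {a b : ℝ} {f : ℝ → Set ℝ} (hs : SIncOn a b f) (hf : MFOn a b f) (k : ℕ) :
    SIncOn a b (Iter f k) := by
  intro x hx y hy hxy
  induction k with
  | zero => simpa [Iter] using hxy
  | succ k ih =>
    intro u hu v hv
    obtain ⟨u₁, hu₁, hu⟩ := mem_iter_succ.1 hu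
    obtain ⟨v₁, hv₁, hv⟩ := mem_iter_succ.1 hv
    exact hs u₁ (hf.iter_subset k hx hu₁) v₁ (hf.iter_subset k hy hv₁) (ih u₁ hu₁ v₁ hv₁) u hu v hv

/-- Jumps of an iterate of a strictly increasing multifunction remain jumps of later iterates. -/
theorem SIncOn.jumps_iter_subset {a b : ℝ} {f : ℝ → Set ℝ} (hs : SIncOn a b f)
    (hf : MFOn a b f) (k p : ℕ) : Jumps a b (Iter f k) ⊆ Jumps a b (Iter f (k + p)) := by
  rintro x ⟨hx, hn⟩
  obtain ⟨u, hu, v, hv, huv⟩ := hn.exists_lt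
  have hu₁ := hf.iter_subset k hx hu
  have hv₁ := hf.iter_subset k hx hv
  obtain ⟨s, hs'⟩ := hf.iter_nonempty p hu₁
  obtain ⟨t, ht⟩ := hf.iter_nonempty p hv₁
  exact ⟨hx, s, mem_iter_add.2 ⟨u, hu, hs'⟩, t, mem_iter_add.2 ⟨v, hv, ht⟩,
    (hs.iter hf p u hu₁ v hv₁ huv s hs' t ht).ne⟩

/-- If some iterate of `f` maps `x` strictly below `x`, then so does `f`. -/
theorem SIncOn.lt_of_iter_lt {a b : ℝ} {f : ℝ → Set ℝ} (hs : SIncOn a b f) (hf : MFOn a b f)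
    {n : ℕ} {x : ℝ} (hx : x ∈ Icc a b) (h : ∀ u ∈ Iter f n x, u < x) : ∀ u ∈ f x, u < x := by
  intro u hu
  by_contra! hxu
  have key : ∀ k, ∃ v ∈ Iter f k x, x ≤ v := by
    intro k
    induction k with
    | zero => exact ⟨x, by simp [Iter], le_rfl⟩
    | succ k ih =>
      obtain ⟨v, hv, hxv⟩ := ih
      rcases hxv.eq_or_lt with rfl | hlt
      · exact ⟨u, mem_iter_succ.2 ⟨_, hv, hu⟩, hxu⟩
      · have hv₁ := hf.iter_subset k hx hv
        obtain ⟨w, hw⟩ := (hf v hv₁).1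
        exact ⟨w, mem_iter_succ.2 ⟨v, hv, hw⟩, hxu.trans (hs x hx v hv₁ hlt u hu w hw).le⟩
  obtain ⟨v, hv, hxv⟩ := key n
  exact (h v hv).not_ge hxv

/-- If `f` maps `x` strictly below `x`, the successive images of `x` are strictly decreasing. -/
theorem SIncOn.iter_lt_iter {a b : ℝ} {f : ℝ → Set ℝ} (hs : SIncOn a b f) (hf : MFOn a b f)
    {x : ℝ} (hx : x ∈ Icc a b) (h : ∀ u ∈ f x, u < x) {j k : ℕ} (hjk : j < k) :
    ∀ u ∈ Iter f k x, ∀ v ∈ Iter f j x, u < v := by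
  have step : ∀ k, ∀ u ∈ Iter f (k + 1) x, ∀ v ∈ Iter f k x, u < v := by
    intro k
    induction k with
    | zero => simpa [Iter] using h
    | succ k ih =>
      intro u hu v hv
      obtain ⟨u₁, hu₁, hu⟩ := mem_iter_succ.1 hu
      obtain ⟨v₁, hv₁, hv⟩ := mem_iter_succ.1 hv
      exact hs u₁ (hf.iter_subset _ hx hu₁) v₁ (hf.iter_subset _ hx hv₁) (ih u₁ hu₁ v₁ hv₁)
        u hu v hv
  induction k, hjk using Nat.le_induction with
  | base => exact step j
  | succ k _ ih =>
    intro u hu v hv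
    obtain ⟨w, hw⟩ := hf.iter_nonempty k hx
    exact (step k u hu w hw).trans (ih w hw v hv)

/-- A strictly increasing multifunction of intensity one has the same jumps as its square. -/
theorem Exclusive.jumps_iter_two {a b : ℝ} {F : ℝ → Set ℝ} (hF : Exclusive a b F)
    (hs : SIncOn a b F) (hne : (Jumps a b F).Nonempty) :
    Jumps a b (Iter F 2) = Jumps a b F := by
  have h1 : Iter F 1 = F := funext (iter_one F)
  have hcard := hF.2.2.1
  simp only [mem_ofPred_eq, Nat.reduceAdd, h1] at hcard
  have hsub := hs.jumps_iter_subset hF.1.1 1 1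
  rw [h1] at hsub
  have hpos : 0 < (Jumps a b F).ncard := (ncard_pos hF.2.1).2 hne
  exact (eq_of_subset_of_ncard_le hsub hcard.ge (finite_of_ncard_pos (hcard ▸ hpos))).symm

/-- case (J3).  If `J(F) ∩ F(cᵢ)` consists of exactly `ℓ` jumps, none equal to
`cᵢ`, with `1 ≤ ℓ < m - 1`, then `F` has no strictly increasing usc iterative root in 𝓕(I)
of any order `n > m - ℓ + 1`. -/
theorem stmt14 (a b : ℝ) (hab : a < b) (F : ℝ → Set ℝ) (hF : Exclusive a b F)
    (hH : HypH a b F) (m ℓ : ℕ) (c : ℕ → ℝ) (hc : JumpEnum a b F m c)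
    (i0 : ℕ) (hi0 : 1 ≤ i0 ∧ i0 ≤ m)
    (hl1 : 1 ≤ ℓ) (hl2 : ℓ < m - 1)
    (hJ3 : (Jumps a b F ∩ F (c i0)).ncard = ℓ)
    (hnot : c i0 ∉ F (c i0)) :
    ∀ n : ℕ, m - ℓ + 1 < n →
      ¬ ∃ f : ℝ → Set ℝ, ClassF a b f ∧ SIncOn a b f ∧
        ∀ x ∈ Icc a b, Iter f n x = F x := by
  rintro n hn ⟨f, ⟨hf, -, -⟩, hs, hroot⟩
  obtain ⟨hc0, hcm, hcmono, hJ⟩ := hc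
  have hxo : c i0 ∈ Ioo a b :=
    ⟨hc0 ▸ hcmono 0 i0 (by omega) (by omega), hcm ▸ hcmono i0 (m + 1) (by omega) le_rfl⟩
  have hx : c i0 ∈ Icc a b := Ioo_subset_Icc_self hxo
  have hlt : ∀ u ∈ f (c i0), u < c i0 :=
    hs.lt_of_iter_lt hf (n := n) hx (by rw [hroot _ hx]; exact hH.2.1 _ hxo)
  have hJJ : Jumps a b (Iter F 2) = Jumps a b F :=
    hF.jumps_iter_two hH.1 ⟨c i0, hJ ▸ ⟨i0, hi0.1, hi0.2, rfl⟩⟩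
  have hdouble : Jumps a b (Iter f (n + n)) ⊆ Jumps a b F := by
    rw [← hJJ]
    rintro x ⟨hx, hnt⟩
    refine ⟨hx, hnt.mono fun u hu => ?_⟩
    obtain ⟨y, hy, hu⟩ := mem_iter_add.1 hu
    have hyI := hf.iter_subset n hx hy
    rw [hroot x hx] at hy
    rw [hroot y hyI] at hu
    exact mem_iter_succ.2 ⟨y, by rwa [iter_one], hu⟩
  obtain ⟨y, hyJ, hy⟩ : (Jumps a b F ∩ F (c i0)).Nonempty :=
    nonempty_of_ncard_ne_zero (by omega)
  have hchain : ∀ k : ℕ, ∃ z, k < n → z ∈ Iter f k (c i0) ∧ z ∈ Jumps a b F := by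
    intro k
    by_cases hk : k < n
    · rw [← hroot _ hx, show n = k + (n - k) by omega] at hy
      obtain ⟨z, hz, hyz⟩ := mem_iter_add.1 hy
      refine ⟨z, fun _ => ⟨hz, hdouble ?_⟩⟩
      rw [show n + n = (n - k + n) + k by omega]
      refine hs.jumps_iter_subset hf _ _ ⟨hf.iter_subset k hx hz, ?_⟩
      have hnt := hyJ.2
      rw [← hroot y hyJ.1] at hnt
      exact hnt.mono fun u hu => mem_iter_add.2 ⟨y, hyz, hu⟩
    · exact ⟨0, fun h => absurd h hk⟩
  choose z hz using hchain
  have hinj : InjOn z (Iio n) := by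
    intro i hi j hj hij
    by_contra hne
    rcases lt_or_gt_of_ne hne with h | h
    · exact (hs.iter_lt_iter hf hx hlt h _ (hz j hj).1 _ (hz i hi).1).ne hij.symm
    · exact (hs.iter_lt_iter hf hx hlt h _ (hz i hi).1 _ (hz j hj).1).ne hij
  have hdisj : Disjoint (z '' Iio n) (Jumps a b F ∩ F (c i0)) := by
    rw [disjoint_left]
    rintro _ ⟨k, hk, rfl⟩ ⟨-, h⟩
    rw [← hroot _ hx] at h
    exact (hs.iter_lt_iter hf hx hlt hk _ h _ (hz k hk).1).ne rfl
  have hsub : z '' Iio n ∪ (Jumps a b F ∩ F (c i0)) ⊆ Jumps a b F := by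
    refine union_subset ?_ inter_subset_left
    rintro _ ⟨k, hk, rfl⟩
    exact (hz k hk).2
  have hcard := ncard_le_ncard hsub hF.2.1
  rw [ncard_union_eq hdisj ((finite_Iio n).image z) (hF.2.1.subset inter_subset_left), hJ3,
    hinj.ncard_image, ← Finset.coe_Iio, ncard_coe_finset, Nat.card_Iio] at hcard
  have hm : (Jumps a b F).ncard ≤ m := by
    have hJ' : Jumps a b F = c '' (Finset.Icc 1 m : Set ℕ) := by
      rw [hJ]
      ext x
      simp [and_assoc, eq_comm]
    rw [hJ']
    refine (ncard_image_le (Finset.finite_toSet _)).trans ?_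
    rw [ncard_coe_finset, Nat.card_Icc]
    omega
  omega
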